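/- Let A be a weighted pushdown system with state set Q and stack alphabet Γ, let c₁, c₂ be configurations and n ∈ ℤ, and let d ∈ ℕ be the minimal additional stack height among all valid paths from c₁ to c₂ with total weight at least n. If d ≥ (|Q|·|Γ|)², then there exists a valid path π* from c₁ to c₂ with additional stack height d that has a pumpable pair (p₁,p₂) with w(p₁) + w(p₂) > 0. -/

import Mathlib

open scoped BigOperators

namespace PDS

/-- Stack commands over a stack alphabet `Γ`. -/
inductive Com (Γ : Type) where
  | skip : Com Γ
  | pop : Com Γ
  | push (z : Γ) : Com Γ
  deriving DecidableEq

/-- Action of a stack command on a stack string (top of stack at the head). -/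
def Com.apply {Γ : Type} : Com Γ → List Γ → List Γ
  | .skip, α => α
  | .pop, α => α.tail
  | .push z, α => z :: α

/-- A transition (edge) of a pushdown system. -/
structure Edge (Q Γ : Type) where
  q1 : Q
  top : Γ
  q2 : Q
  com : Com Γ
  deriving DecidableEq

/-- A weighted pushdown system. -/
structure WPS (Q Γ : Type) where
  q0 : Q
  bot : Γ
  E : Set (Edge Q Γ)
  w : Edge Q Γ → ℤ
  no_push_bot : ∀ e ∈ E, e.com ≠ Com.push bot
  no_pop_bot : ∀ e ∈ E, e.top = bot → e.com ≠ Com.pop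

variable {Q Γ : Type}

/-- A configuration: stack string (top at head) together with a state. -/
abbrev Config (Q Γ : Type) := List Γ × Q

/-- A genuine configuration has a nonempty stack string. -/
def IsConfig (c : Config Q Γ) : Prop := c.1 ≠ []

/-- The initial configuration `(⊥, q₀)`. -/
def WPS.start (A : WPS Q Γ) : Config Q Γ := ([A.bot], A.q0)

/-- The configuration obtained by taking the edge `e` from `c`. -/
def next (c : Config Q Γ) (e : Edge Q Γ) : Config Q Γ := (e.com.apply c.1, e.q2)

/-- The edge `e` is enabled at configuration `c`. -/
def WPS.Enabled (A : WPS Q Γ) (c : Config Q Γ) (e : Edge Q Γ) : Prop :=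
  e ∈ A.E ∧ c.2 = e.q1 ∧ c.1.head? = some e.top

/-- Validity of a finite path, given by a start configuration and a list of edges. -/
def WPS.Valid (A : WPS Q Γ) : Config Q Γ → List (Edge Q Γ) → Prop
  | _, [] => True
  | c, e :: es => A.Enabled c e ∧ A.Valid (next c e) es

/-- Last configuration of the finite path `(c, es)`. -/
def endc (c : Config Q Γ) (es : List (Edge Q Γ)) : Config Q Γ := es.foldl next c

/-- The list of configurations along the finite path `(c, es)`. -/
def trace (c : Config Q Γ) (es : List (Edge Q Γ)) : List (Config Q Γ) :=
  List.scanl next c es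

/-- Total weight of a finite path. -/
def WPS.wt (A : WPS Q Γ) (es : List (Edge Q Γ)) : ℤ := (es.map A.w).sum

/-- Stack height of a configuration. -/
def height (c : Config Q Γ) : ℕ := c.1.length

/-- Stack height of a finite path: maximal stack height along it. -/
def SH (c : Config Q Γ) (es : List (Edge Q Γ)) : ℕ :=
  ((trace c es).map height).foldr max 0

/-- Additional stack height of a finite path. -/
def ASH (c : Config Q Γ) (es : List (Edge Q Γ)) : ℕ :=
  SH c es - max (height c) (height (endc c es))

/-- The first configuration of the path is a local minima: its stack string is a
prefix (here: suffix of the list, since the top is at the head) of all stack strings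
along the path. -/
def FirstMin (c : Config Q Γ) (es : List (Edge Q Γ)) : Prop :=
  ∀ c' ∈ trace c es, c.1 <:+ c'.1

/-- The edge sequence obtained from `u ++ p₁ ++ v ++ p₂ ++ x` by repeating `p₁` and
`p₂` each `j` times in place. -/
def pumped (u p₁ v p₂ x : List (Edge Q Γ)) (j : ℕ) : List (Edge Q Γ) :=
  u ++ (List.replicate j p₁).flatten ++ v ++ (List.replicate j p₂).flatten ++ x

/-- `(p₁, p₂)` is a pumpable pair of paths for the path `(c, es)`. -/
def WPS.PumpablePair (A : WPS Q Γ) (c : Config Q Γ) (es p₁ p₂ : List (Edge Q Γ)) : Prop :=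
  p₁ ≠ [] ∧ p₂ ≠ [] ∧
    ∃ u v x, es = u ++ p₁ ++ v ++ p₂ ++ x ∧
      ∀ j : ℕ, A.Valid c (pumped u p₁ v p₂ x j)

/-- The path `(c, es)` has a pumpable pair of paths. -/
def WPS.HasPumpablePair (A : WPS Q Γ) (c : Config Q Γ) (es : List (Edge Q Γ)) : Prop :=
  ∃ p₁ p₂, A.PumpablePair c es p₁ p₂

/-- `(c, es)` is a good cycle. -/
def WPS.GoodCycle (A : WPS Q Γ) (c : Config Q Γ) (es : List (Edge Q Γ)) : Prop :=
  A.Valid c es ∧ 0 < A.wt es ∧ FirstMin c es ∧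
    (endc c es).2 = c.2 ∧ (endc c es).1.head? = c.1.head?

/-- `A` has a good cycle reachable from the configuration `c`. -/
def WPS.ReachableGoodCycleFrom (A : WPS Q Γ) (c : Config Q Γ) : Prop :=
  ∃ es₀ es, A.Valid c es₀ ∧ A.GoodCycle (endc c es₀) es

/-- `A` has a good cycle (at some configuration). -/
def WPS.HasGoodCycle (A : WPS Q Γ) : Prop :=
  ∃ c es, IsConfig c ∧ A.GoodCycle c es

/-- The finite path `(c, es)` contains a good cycle. -/
def ContainsGoodCycle (A : WPS Q Γ) (c : Config Q Γ) (es : List (Edge Q Γ)) : Prop :=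
  ∃ es₁ es₂, es = es₁ ++ es₂ ∧ A.GoodCycle (endc c es₁) es₂

/-- Configurations along an infinite path given by an infinite edge sequence. -/
def confs (c : Config Q Γ) (f : ℕ → Edge Q Γ) : ℕ → Config Q Γ
  | 0 => c
  | n + 1 => next (confs c f n) (f n)

/-- Validity of the infinite path `(c, f)`. -/
def WPS.ValidInf (A : WPS Q Γ) (c : Config Q Γ) (f : ℕ → Edge Q Γ) : Prop :=
  ∀ n, A.Enabled (confs c f n) (f n)

/-- Average weight of the prefix of length `n+1` of an infinite path. -/
noncomputable def avgPref (A : WPS Q Γ) (f : ℕ → Edge Q Γ) (n : ℕ) : ℝ :=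
  (∑ i ∈ Finset.range (n + 1), (A.w (f i) : ℝ)) / (n + 1)

/-- Limit-sup of the averages along an infinite path. -/
noncomputable def LimSupAvg (A : WPS Q Γ) (f : ℕ → Edge Q Γ) : ℝ :=
  Filter.limsup (avgPref A f) Filter.atTop

/-- Limit-inf of the averages along an infinite path. -/
noncomputable def LimInfAvg (A : WPS Q Γ) (f : ℕ → Edge Q Γ) : ℝ :=
  Filter.liminf (avgPref A f) Filter.atTop

/-- An infinite edge sequence is ultimately periodic. -/
def UltPeriodic (f : ℕ → Edge Q Γ) : Prop :=
  ∃ N p : ℕ, 0 < p ∧ ∀ n, N ≤ n → f (n + p) = f n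

/-- The infinite path `(c, f)` is stack bounded. -/
def StackBounded (c : Config Q Γ) (f : ℕ → Edge Q Γ) : Prop :=
  ∃ n : ℕ, ∀ k, height (confs c f k) ≤ n

/-- Non-decreasing path: a valid path whose first configuration is a local minima. -/
def WPS.NonDec (A : WPS Q Γ) (c : Config Q Γ) (es : List (Edge Q Γ)) : Prop :=
  A.Valid c es ∧ FirstMin c es

/-- Summary function, valued in `EReal`: `⊥` means there is no non-decreasing path
from `(⊥γ,q₁)` to `(⊥γ,q₂)`, `⊤` means `ω` (weights unbounded from above), and
otherwise the value is the maximal weight of such a path. -/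
noncomputable def WPS.summary (A : WPS Q Γ) (q₁ : Q) (γ : Γ) (q₂ : Q) : EReal :=
  sSup { x : EReal | ∃ es, A.NonDec ([γ, A.bot], q₁) es ∧
    endc ([γ, A.bot], q₁) es = ([γ, A.bot], q₂) ∧ x = ((A.wt es : ℝ) : EReal) }

/-- Stack height bounded summary function: as `summary` but only over non-decreasing
paths of additional stack height at most `d`. -/
noncomputable def WPS.summaryBdd (A : WPS Q Γ) (d : ℕ) (q₁ : Q) (γ : Γ) (q₂ : Q) : EReal :=
  sSup { x : EReal | ∃ es, A.NonDec ([γ, A.bot], q₁) es ∧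
    endc ([γ, A.bot], q₁) es = ([γ, A.bot], q₂) ∧ ASH ([γ, A.bot], q₁) es ≤ d ∧
    x = ((A.wt es : ℝ) : EReal) }

/-- Edges of the summary graph `Gr(A)` together with their weights in `EReal`
(`⊤` plays the role of `ω`): skip edges weighted by the summary function and push
edges weighted by the corresponding transition weight. -/
def WPS.GrEdge (A : WPS Q Γ) (v₁ v₂ : Q × Γ) (x : EReal) : Prop :=
  (v₁.2 = v₂.2 ∧ A.summary v₁.1 v₁.2 v₂.1 ≠ ⊥ ∧ x = A.summary v₁.1 v₁.2 v₂.1) ∨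
  (∃ e ∈ A.E, e.q1 = v₁.1 ∧ e.top = v₁.2 ∧ e.q2 = v₂.1 ∧ e.com = Com.push v₂.2 ∧
    x = ((A.w e : ℝ) : EReal))

/-- The summary graph `Gr(A)` has a positive simple cycle: a simple cycle containing
an `ω`-edge or whose total weight is positive. -/
def WPS.PosSimpleCycle (A : WPS Q Γ) : Prop :=
  ∃ (k : ℕ) (v : Fin (k + 1) → Q × Γ) (x : Fin (k + 1) → EReal),
    Function.Injective v ∧ (∀ i, A.GrEdge (v i) (v (i + 1)) (x i)) ∧
    ((∃ i, x i = ⊤) ∨ (0 : EReal) < ∑ i, x i)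

/-- Weight of a finite path under the shifted weight function `w + r`. -/
def WPS.wtQ (A : WPS Q Γ) (r : ℚ) (es : List (Edge Q Γ)) : ℚ :=
  (es.map (fun e => (A.w e : ℚ) + r)).sum

/-- The shifted system `A^r` (weight function `w + r`) has a good cycle. -/
def WPS.GoodCycleShift (A : WPS Q Γ) (r : ℚ) : Prop :=
  ∃ c es, IsConfig c ∧ A.Valid c es ∧ 0 < A.wtQ r es ∧ FirstMin c es ∧
    (endc c es).2 = c.2 ∧ (endc c es).1.head? = c.1.head?

end PDS

namespace PDS

variable {Q Γ : Type}

theorem endc_append (c : Config Q Γ) (a b : List (Edge Q Γ)) :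
    endc c (a ++ b) = endc (endc c a) b := by
  simp [endc, List.foldl_append]

theorem WPS.valid_append (A : WPS Q Γ) (c : Config Q Γ) (a b : List (Edge Q Γ)) :
    A.Valid c (a ++ b) ↔ A.Valid c a ∧ A.Valid (endc c a) b := by
  induction a generalizing c with
  | nil => simp [WPS.Valid, endc]
  | cons e es ih =>
    simp only [List.cons_append, WPS.Valid, ih, and_assoc]
    rfl

theorem WPS.wt_append (A : WPS Q Γ) (a b : List (Edge Q Γ)) :
    A.wt (a ++ b) = A.wt a + A.wt b := by
  simp [WPS.wt]

theorem SH_nil (c : Config Q Γ) : SH c [] = height c := by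
  simp [SH, trace]

theorem SH_cons (c : Config Q Γ) (e : Edge Q Γ) (es : List (Edge Q Γ)) :
    SH c (e :: es) = max (height c) (SH (next c e) es) := by
  simp [SH, trace]

theorem height_le_SH (c : Config Q Γ) (es : List (Edge Q Γ)) : height c ≤ SH c es := by
  cases es with
  | nil => rw [SH_nil]
  | cons e es => rw [SH_cons]; exact le_max_left _ _

theorem SH_append (c : Config Q Γ) (a b : List (Edge Q Γ)) :
    SH c (a ++ b) = max (SH c a) (SH (endc c a) b) := by
  induction a generalizing c with
  | nil => simpa [SH_nil, endc] using height_le_SH c b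
  | cons e es ih =>
    rw [List.cons_append, SH_cons, SH_cons, ih, max_assoc]
    rfl

/-- The maximal stack height is attained along the path. -/
theorem exists_height_eq_SH (c : Config Q Γ) (es : List (Edge Q Γ)) :
    ∃ t ≤ es.length, height (endc c (es.take t)) = SH c es := by
  induction es generalizing c with
  | nil => exact ⟨0, le_rfl, by simp [SH_nil, endc]⟩
  | cons e es ih =>
    rw [SH_cons]
    rcases le_total (height c) (SH (next c e) es) with h | h
    · obtain ⟨t, ht, hh⟩ := ih (next c e)
      exact ⟨t + 1, by simpa using ht, by rw [max_eq_right h, ← hh]; rfl⟩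
    · exact ⟨0, by simp, by rw [max_eq_left h]; rfl⟩

theorem next_append {e : Edge Q Γ} {α : List Γ} (hα : α ≠ []) (β : List Γ) (q : Q) :
    next (α ++ β, q) e = ((next (α, q) e).1 ++ β, (next (α, q) e).2) := by
  cases α with
  | nil => exact absurd rfl hα
  | cons a α =>
    simp only [next]
    cases e.com <;> simp [Com.apply]

/-- A valid path stays valid when its stacks are put on top of `β`. -/
theorem WPS.Valid.frame {A : WPS Q Γ} {α : List Γ} {q : Q} {es : List (Edge Q Γ)}
    (h : A.Valid (α, q) es) (β : List Γ) :
    A.Valid (α ++ β, q) es ∧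
      endc (α ++ β, q) es = ((endc (α, q) es).1 ++ β, (endc (α, q) es).2) ∧
      SH (α ++ β, q) es = SH (α, q) es + β.length := by
  induction es generalizing α q with
  | nil => simp [WPS.Valid, endc, SH_nil, height]
  | cons e es ih =>
    obtain ⟨⟨h1, h2, h3⟩, hv⟩ := h
    have hα : α ≠ [] := by rintro rfl; simp at h3
    obtain ⟨i1, i2, i3⟩ := ih (α := (next (α, q) e).1) (q := (next (α, q) e).2) hv
    have hn := next_append (e := e) hα β q
    refine ⟨⟨⟨h1, h2, ?_⟩, ?_⟩, ?_, ?_⟩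
    · cases α with
      | nil => exact absurd rfl hα
      | cons a α => simpa using h3
    · rw [hn]; exact i1
    · change endc (next (α ++ β, q) e) es = _
      rw [hn]; exact i2
    · rw [SH_cons, SH_cons, hn, i3, ← max_add_add_right]
      simp only [height, List.length_append]

/-- A valid path whose stacks all stay strictly above `β` does not depend on `β`. -/
theorem WPS.Valid.unframe {A : WPS Q Γ} {α β : List Γ} {q : Q} {es : List (Edge Q Γ)}
    (h : A.Valid (α ++ β, q) es)
    (hh : ∀ k ≤ es.length, β.length < height (endc (α ++ β, q) (es.take k))) :
    A.Valid (α, q) es := by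
  induction es generalizing α q with
  | nil => trivial
  | cons e es ih =>
    obtain ⟨⟨h1, h2, h3⟩, hv⟩ := h
    have hα : α ≠ [] := by
      rintro rfl
      simpa [endc, height] using hh 0 (by simp)
    have hn := next_append (e := e) hα β q
    refine ⟨⟨h1, h2, ?_⟩, ?_⟩
    · cases α with
      | nil => exact absurd rfl hα
      | cons a α => simpa using h3
    · refine ih (α := (next (α, q) e).1) (q := (next (α, q) e).2) (hn ▸ hv) fun k hk => ?_
      rw [← hn]
      exact hh (k + 1) (by simpa using hk)

theorem height_next_le (c : Config Q Γ) (e : Edge Q Γ) :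
    height (next c e) ≤ height c + 1 ∧ height c ≤ height (next c e) + 1 := by
  simp only [next, height]
  cases e.com <;> simp [Com.apply] <;> omega

theorem height_take_succ_le (c : Config Q Γ) (es : List (Edge Q Γ)) (k : ℕ) :
    height (endc c (es.take (k + 1))) ≤ height (endc c (es.take k)) + 1 ∧
      height (endc c (es.take k)) ≤ height (endc c (es.take (k + 1))) + 1 := by
  rcases lt_or_ge k es.length with hk | hk
  · rw [List.take_succ_eq_append_getElem hk, endc_append]
    exact height_next_le _ _
  · rw [List.take_of_length_le hk, List.take_of_length_le (by omega)]
    omega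

/-- The last visit to level `h` before time `t`. -/
theorem exists_last_visit {H : ℕ → ℕ} (hs : ∀ k, H (k + 1) ≤ H k + 1) {h : ℕ} (h0 : H 0 ≤ h) :
    ∀ t, h ≤ H t → ∃ i ≤ t, H i = h ∧ ∀ k, i ≤ k → k ≤ t → h ≤ H k := by
  intro t
  induction t with
  | zero =>
    intro ht
    refine ⟨0, le_rfl, by omega, fun k _ hk => ?_⟩
    obtain rfl : k = 0 := by omega
    exact ht
  | succ t ih =>
    intro ht
    rcases ht.eq_or_lt with heq | hlt
    · refine ⟨t + 1, le_rfl, heq.symm, fun k h1 h2 => ?_⟩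
      obtain rfl : k = t + 1 := by omega
      exact ht
    · obtain ⟨i, hi, hHi, hk⟩ := ih (by have := hs t; omega)
      refine ⟨i, by omega, hHi, fun k h1 h2 => ?_⟩
      rcases h2.eq_or_lt with rfl | h2
      · exact ht
      · exact hk k h1 (by omega)

/-- The last visit to level `h` before `t` and the first one after `t`. -/
theorem exists_surrounding_visits {H : ℕ → ℕ}
    (hs : ∀ k, H (k + 1) ≤ H k + 1 ∧ H k ≤ H (k + 1) + 1) {h t L : ℕ}
    (h0 : H 0 ≤ h) (hL : H L ≤ h) (htL : t ≤ L) (ht : h ≤ H t) :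
    ∃ i j, i ≤ t ∧ t ≤ j ∧ j ≤ L ∧ H i = h ∧ H j = h ∧ ∀ k, i ≤ k → k ≤ j → h ≤ H k := by
  obtain ⟨i, hi, hHi, hki⟩ := exists_last_visit (fun k => (hs k).1) h0 t ht
  obtain ⟨j, hj, hHj, hkj⟩ := exists_last_visit (H := fun k => H (L - k)) (h := h)
    (fun k => by
      rcases lt_or_ge k L with hk | hk
      · have := (hs (L - (k + 1))).2
        rwa [show L - (k + 1) + 1 = L - k by omega] at this
      · rw [show L - (k + 1) = L - k by omega]; omega) hL (L - t)
      (by rwa [show L - (L - t) = t by omega])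
  refine ⟨i, L - j, hi, by omega, by omega, hHi, hHj, fun k h1 h2 => ?_⟩
  rcases le_total k t with hk | hk
  · exact hki k h1 hk
  · have := hkj (L - k) (by omega) (by omega)
    change h ≤ H (L - (L - k)) at this
    rwa [show L - (L - k) = k by omega] at this

/-- The part of a valid path between times `i` and `j` runs independently of the stack
content `β` which it never touches. -/
theorem WPS.Valid.unframe_segment {A : WPS Q Γ} {c : Config Q Γ} {es : List (Edge Q Γ)}
    (hv : A.Valid c es) {i j : ℕ} (hij : i ≤ j) (hj : j ≤ es.length) {α β : List Γ} {q : Q}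
    (hi : endc c (es.take i) = (α ++ β, q))
    (hh : ∀ k, i ≤ k → k ≤ j → β.length < height (endc c (es.take k))) :
    ∃ p, es.take j = es.take i ++ p ∧ p.length = j - i ∧ A.Valid (α, q) p ∧
      ∃ α', α' ≠ [] ∧ endc (α, q) p = (α', (endc c (es.take j)).2) ∧
        (endc c (es.take j)).1 = α' ++ β := by
  have hp : es.take j = es.take i ++ (es.drop i).take (j - i) := by
    rw [← List.take_add, Nat.add_sub_cancel' hij]
  set p := (es.drop i).take (j - i) with hpdef
  have hlen : p.length = j - i := by
    simp only [hpdef, List.length_take, List.length_drop]; omega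
  have hvp : A.Valid (α ++ β, q) p := by
    have h1 : A.Valid c (es.take j) := by
      rw [← List.take_append_drop j es, A.valid_append] at hv
      exact hv.1
    rw [hp, A.valid_append, hi] at h1
    exact h1.2
  have hvα : A.Valid (α, q) p := by
    refine hvp.unframe fun k hk => ?_
    have := hh (i + k) (by omega) (by omega)
    rwa [show es.take (i + k) = es.take i ++ p.take k by
      rw [List.take_add, hpdef, List.take_take, min_eq_left (by omega)], endc_append, hi] at this
  have hend : endc c (es.take j) = ((endc (α, q) p).1 ++ β, (endc (α, q) p).2) := by
    rw [hp, endc_append, hi]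
    exact (hvα.frame β).2.1
  refine ⟨p, hp, hlen, hvα, (endc (α, q) p).1, ?_, ?_, by rw [hend]⟩
  · intro h0
    have := hh j hij le_rfl
    rw [hend, h0] at this
    simp [height] at this
  · rw [hend]

theorem WPS.Valid.iterate_push {A : WPS Q Γ} {γ : Γ} {τ : List Γ} {q : Q} {p : List (Edge Q Γ)}
    (hv : A.Valid ([γ], q) p) (he : endc ([γ], q) p = (γ :: τ, q)) (β : List Γ) (j : ℕ) :
    A.Valid (γ :: β, q) (List.replicate j p).flatten ∧
      endc (γ :: β, q) (List.replicate j p).flatten =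
        (γ :: ((List.replicate j τ).flatten ++ β), q) := by
  induction j generalizing β with
  | zero => simp [WPS.Valid, endc]
  | succ j ih =>
    obtain ⟨f1, f2, -⟩ := hv.frame β
    rw [he] at f2
    simp only [List.cons_append, List.nil_append] at f1 f2
    rw [List.replicate_succ, List.flatten_cons, A.valid_append, endc_append, f2]
    refine ⟨⟨f1, (ih _).1⟩, ?_⟩
    rw [(ih _).2, List.replicate_succ']
    simp

theorem WPS.Valid.iterate_pop {A : WPS Q Γ} {γ : Γ} {τ : List Γ} {q : Q} {p : List (Edge Q Γ)}
    (hv : A.Valid (γ :: τ, q) p) (he : endc (γ :: τ, q) p = ([γ], q)) (β : List Γ) (j : ℕ) :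
    A.Valid (γ :: ((List.replicate j τ).flatten ++ β), q) (List.replicate j p).flatten ∧
      endc (γ :: ((List.replicate j τ).flatten ++ β), q) (List.replicate j p).flatten =
        (γ :: β, q) := by
  induction j with
  | zero => simp [WPS.Valid, endc]
  | succ j ih =>
    obtain ⟨f1, f2, -⟩ := hv.frame ((List.replicate j τ).flatten ++ β)
    rw [he] at f2
    simp only [List.cons_append, List.nil_append] at f1 f2
    simp only [List.replicate_succ, List.flatten_cons, A.valid_append, endc_append,
      List.append_assoc, f2]
    exact ⟨⟨f1, ih.1⟩, ih.2⟩

/-- A valid path which rises at least `(|Q|·|Γ|)²` above both of its ends has a pumpable pair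
whose removal keeps the end points and does not increase the stack height. -/
theorem WPS.Valid.exists_pumpablePair [Fintype Q] [Fintype Γ] {A : WPS Q Γ} {c : Config Q Γ}
    {es : List (Edge Q Γ)} {d : ℕ} (hv : A.Valid c es) (hc : IsConfig c)
    (hSH : max (height c) (height (endc c es)) + d ≤ SH c es)
    (hd : (Fintype.card Q * Fintype.card Γ) ^ 2 ≤ d) :
    ∃ u p₁ v p₂ x, es = u ++ p₁ ++ v ++ p₂ ++ x ∧ p₁ ≠ [] ∧ p₂ ≠ [] ∧
      (∀ j, A.Valid c (pumped u p₁ v p₂ x j)) ∧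
      endc c (u ++ v ++ x) = endc c es ∧ SH c (u ++ v ++ x) ≤ SH c es := by
  obtain ⟨t, htL, ht⟩ := exists_height_eq_SH c es
  set m := max (height c) (height (endc c es)) with hm
  have hm1 : 1 ≤ m := le_max_of_le_left (List.length_pos_of_ne_nil hc)
  set H : ℕ → ℕ := fun k => height (endc c (es.take k)) with hH
  have key : ∀ k : Fin (d + 1), ∃ i j, ∃ y z : Q × Γ, ∃ β : List Γ,
      i ≤ t ∧ t ≤ j ∧ j ≤ es.length ∧ H i = m + k ∧ H j = m + k ∧
      (∀ l, i ≤ l → l ≤ j → m + k ≤ H l) ∧ endc c (es.take i) = (y.2 :: β, y.1) ∧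
      (endc c (es.take j)).2 = z.1 ∧ (endc c (es.take j)).1.head? = some z.2 := by
    intro k
    have hk := k.2
    obtain ⟨i, j, hi, hj, hjL, hHi, hHj, hl⟩ := exists_surrounding_visits (H := H)
      (height_take_succ_le c es) (h := m + k) (t := t) (L := es.length)
      (by have : H 0 = height c := by simp [hH, endc]
          rw [this]; omega)
      (by have : H es.length = height (endc c es) := by simp [hH]
          rw [this]; omega) htL (by change _ ≤ height (endc c (es.take t)); omega)
    have e1 : (endc c (es.take i)).1 ≠ [] := by
      intro h0
      simp only [hH, height, h0, List.length_nil] at hHi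
      omega
    have e2 : (endc c (es.take j)).1 ≠ [] := by
      intro h0
      simp only [hH, height, h0, List.length_nil] at hHj
      omega
    obtain ⟨a, β, hab⟩ := List.exists_cons_of_ne_nil e1
    obtain ⟨b, β', hb⟩ := List.exists_cons_of_ne_nil e2
    exact ⟨i, j, ((endc c (es.take i)).2, a), ((endc c (es.take j)).2, b), β, hi, hj, hjL,
      hHi, hHj, hl, by rw [← hab], rfl, by rw [hb]; rfl⟩
  choose I J Y Z B hI hJ hJL hHI hHJ hl hcI hcJ hcJ' using key
  obtain ⟨k, k', hkk, hYZ⟩ : ∃ k k' : Fin (d + 1), k < k' ∧ (Y k, Z k) = (Y k', Z k') := by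
    obtain ⟨k, k', hne, h⟩ := Fintype.exists_ne_map_eq_of_card_lt (fun k => (Y k, Z k))
      (by simp only [Fintype.card_prod, Fintype.card_fin]; rw [← sq]; omega)
    rcases lt_or_gt_of_ne hne with h' | h'
    · exact ⟨k, k', h', h⟩
    · exact ⟨k', k, h', h.symm⟩
  simp only [Prod.mk.injEq] at hYZ
  obtain ⟨hY, hZ⟩ := hYZ
  have hkk' : (k : ℕ) < k' := hkk
  have hII : I k < I k' := by
    by_contra! hle
    have := hl k' (I k) hle ((hI k).trans (hJ k'))
    have := hHI k
    omega
  have hJJ : J k' < J k := by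
    by_contra! hle
    have := hl k' (J k) ((hI k').trans (hJ k)) hle
    have := hHJ k
    omega
  have hIJ : I k' ≤ J k' := (hI k').trans (hJ k')
  have c1 := hcI k
  have c2 := hcI k'
  have s1 := hcJ k
  have s2 := hcJ k'
  have t1 := hcJ' k
  have t2 := hcJ' k'
  rw [← hY] at c2
  rw [← hZ] at s2 t2
  generalize Y k = y at c1 c2
  generalize Z k = z at s1 s2 t1 t2
  obtain ⟨q, γ⟩ := y
  obtain ⟨q', γ'⟩ := z
  dsimp only at c1 c2 s1 s2 t1 t2
  have lB : (B k).length + 1 = m + k := by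
    have := hHI k
    simpa [hH, c1, height] using this
  have lB' : (B k').length + 1 = m + k' := by
    have := hHI k'
    simpa [hH, c2, height] using this
  obtain ⟨p₁, e₁, l₁, v₁, α₁, n₁, f₁, g₁⟩ := hv.unframe_segment (i := I k) (j := I k')
    (α := [γ]) (β := B k) hII.le (hIJ.trans (hJL k')) c1
    (fun l h1 h2 => by have : m + k ≤ height _ := hl k l h1 (by omega); omega)
  rw [c2] at f₁ g₁
  obtain ⟨τ, rfl, hτ⟩ : ∃ τ, α₁ = γ :: τ ∧ B k' = τ ++ B k := by
    cases α₁ with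
    | nil => exact absurd rfl n₁
    | cons a τ => simp at g₁; exact ⟨τ, by rw [g₁.1], g₁.2⟩
  obtain ⟨v, e₂, l₂, v₂, α₂, n₂, f₂, g₂⟩ := hv.unframe_segment (i := I k') (j := J k')
    (α := [γ]) (β := B k') hIJ (hJL k') c2
    (fun l h1 h2 => by have : m + k' ≤ height _ := hl k' l h1 h2; omega)
  rw [s2] at f₂
  obtain rfl : α₂ = [γ'] := by
    have hlen : ((endc c (es.take (J k'))).1).length = m + k' := hHJ k'
    rw [g₂, List.length_append] at hlen
    obtain ⟨a, rfl⟩ := List.length_eq_one_iff.1 (show α₂.length = 1 by omega)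
    rw [g₂] at t2
    simpa using t2
  have c3 : endc c (es.take (J k')) = ((γ' :: τ) ++ B k, q') := by
    rw [← s2]
    refine Prod.ext ?_ rfl
    rw [g₂, hτ]; rfl
  obtain ⟨p₂, e₃, l₃, v₃, α₃, n₃, f₃, g₃⟩ := hv.unframe_segment (i := J k') (j := J k)
    (α := γ' :: τ) (β := B k) hJJ.le (hJL k) c3
    (fun l h1 h2 => by have : m + k ≤ height _ := hl k l (by omega) h2; omega)
  rw [s1] at f₃
  obtain rfl : α₃ = [γ'] := by
    have hlen : ((endc c (es.take (J k))).1).length = m + k := hHJ k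
    rw [g₃, List.length_append] at hlen
    obtain ⟨a, rfl⟩ := List.length_eq_one_iff.1 (show α₃.length = 1 by omega)
    rw [g₃] at t1
    simpa using t1
  have c4 : endc c (es.take (J k)) = (γ' :: B k, q') := by
    rw [← s1]
    refine Prod.ext ?_ rfl
    rw [g₃]; rfl
  have hes : es = es.take (I k) ++ p₁ ++ v ++ p₂ ++ es.drop (J k) := by
    rw [← e₁, ← e₂, ← e₃, List.take_append_drop]
  set u := es.take (I k) with hu
  set x := es.drop (J k) with hx
  have hvu : A.Valid c u := by
    rw [hes] at hv
    simp only [A.valid_append] at hv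
    exact hv.1.1.1.1
  have hvx : A.Valid (γ' :: B k, q') x := by
    rw [← List.take_append_drop (J k) es, A.valid_append, c4] at hv
    exact hv.2
  have hmid : ∀ β, A.Valid (γ :: β, q) v ∧ endc (γ :: β, q) v = (γ' :: β, q') ∧
      SH (γ :: β, q) v = SH ([γ], q) v + β.length := fun β => by
    simpa [f₂] using v₂.frame β
  refine ⟨u, p₁, v, p₂, x, hes, ?_, ?_, fun j => ?_, ?_, ?_⟩
  · rintro rfl
    simp at l₁; omega
  · rintro rfl
    simp at l₃; omega
  · obtain ⟨a1, a2⟩ := v₁.iterate_push f₁ (B k) j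
    obtain ⟨b1, b2⟩ := v₃.iterate_pop f₃ (B k) j
    obtain ⟨d1, d2, -⟩ := hmid ((List.replicate j τ).flatten ++ B k)
    simp only [pumped, A.valid_append, endc_append, c1, a2, d2, b2]
    exact ⟨⟨⟨⟨hvu, a1⟩, d1⟩, b1⟩, hvx⟩
  · conv_rhs => rw [← List.take_append_drop (J k) es, endc_append, c4]
    simp only [endc_append, c1, (hmid _).2.1]
    rfl
  · have hE : SH c es = SH c (u ++ p₁ ++ v ++ p₂ ++ x) := by rw [← hes]
    have w1 : endc c (u ++ p₁) = (γ :: B k', q) := by rw [← e₁, c2]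
    have w3 : endc c (u ++ p₁ ++ v ++ p₂) = (γ' :: B k, q') := by
      rw [← e₁, ← e₂, ← e₃, c4]
    rw [SH_append _ _ x, SH_append _ _ p₂, SH_append _ _ v, SH_append _ _ p₁, w1, w3,
      (hmid _).2.2] at hE
    rw [hE, SH_append _ _ x, SH_append _ _ v, endc_append, c1, (hmid _).2.1, (hmid _).2.2]
    have : (B k).length ≤ (B k').length := by omega
    omega

end PDS

open PDS in
/-- if `d` is the minimal additional stack height among all valid paths
from `c₁` to `c₂` with total weight at least `n`, and `d ≥ (|Q|·|Γ|)²`, then there is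
a path from `c₁` to `c₂` of additional stack height `d` with a pumpable pair of
positive total weight. -/
theorem heavy_path_with_big_depth_implies_positive_pumpable_pair
    {Q Γ : Type} [Fintype Q] [Fintype Γ]
    (A : WPS Q Γ) (c₁ c₂ : Config Q Γ) (n : ℤ) (d : ℕ)
    (hc₁ : IsConfig c₁)
    (hex : ∃ es, A.Valid c₁ es ∧ endc c₁ es = c₂ ∧ n ≤ A.wt es ∧ ASH c₁ es = d)
    (hmin : ∀ es, A.Valid c₁ es → endc c₁ es = c₂ → n ≤ A.wt es → d ≤ ASH c₁ es)
    (hd : (Fintype.card Q * Fintype.card Γ) ^ 2 ≤ d) :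
    ∃ es p₁ p₂, A.Valid c₁ es ∧ endc c₁ es = c₂ ∧ ASH c₁ es = d ∧
      A.PumpablePair c₁ es p₁ p₂ ∧ 0 < A.wt p₁ + A.wt p₂ := by
  obtain ⟨es, hv, he, hw, ha⟩ := hex
  induction hL : es.length using Nat.strong_induction_on generalizing es with
  | _ L ih =>
  subst hL
  have hpos : 0 < (Fintype.card Q * Fintype.card Γ) ^ 2 := by
    have : 0 < Fintype.card Q := Fintype.card_pos_iff.2 ⟨A.q0⟩
    have : 0 < Fintype.card Γ := Fintype.card_pos_iff.2 ⟨A.bot⟩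
    positivity
  obtain ⟨u, p₁, v, p₂, x, hes, h₁, h₂, hpump, hend, hSH⟩ :=
    hv.exists_pumpablePair (d := d) hc₁ (by unfold ASH at ha; omega) hd
  by_cases hpw : 0 < A.wt p₁ + A.wt p₂
  · exact ⟨es, p₁, p₂, hv, he, ha, ⟨h₁, h₂, u, v, x, hes, hpump⟩, hpw⟩
  have hv' : A.Valid c₁ (u ++ v ++ x) := by simpa [pumped] using hpump 0
  have hw' : n ≤ A.wt (u ++ v ++ x) := by
    rw [hes] at hw
    simp only [A.wt_append] at hw ⊢
    omega
  refine ih _ ?_ (u ++ v ++ x) hv' (hend.trans he) hw' (le_antisymm ?_ ?_) rfl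
  · have := List.length_pos_of_ne_nil h₁
    rw [hes]
    simp only [List.length_append]
    omega
  · rw [← ha, ASH, ASH, hend]
    exact Nat.sub_le_sub_right hSH _
  · exact hmin _ hv' (hend.trans he) hw'
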